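/- arXiv:2603.14735 — 2 statements merged into one kernel-verified Lean document; each statement's English description precedes it below -/
import Mathlib

section
/- Let (N, ∘_λ) be a commutative associative conformal algebra and let D : N → N be a derivation, i.e., a ℂ-linear map with D∂ = ∂D and D(a∘_λ b) = D(a)∘_λ b + a∘_λ D(b) for all a, b. Define [a_λ b] = a∘_λ D(b) − b∘_{−∂−λ} D(a). Then (N, ∘_λ, [·_λ·]) is a transposed Poisson conformal algebra. -/
/-!
We model a `ℂ[∂]`-module as a complex vector space `L` together with an
endomorphism `D` (the action of `∂`).  A `λ`-product (or `λ`-bracket) is a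
`ℂ`-bilinear map `L → L → L[λ]`, where the polynomial `x ∘_λ y = Σₙ λⁿ • cₙ`
is encoded by its finitely supported family of coefficients `ℕ →₀ L`.
Substitution of the variable `λ` by a complex scalar, or by an operator such
as `-∂-λ`, is given by `ev`; since `ℂ` is infinite, an identity of
polynomials in (several) variables `λ, μ, γ` with coefficients in a complex
vector space holds formally if and only if it holds for all complex values
of the variables, which is how all identities are stated below.
-/

namespace ConfFormal

variable {L : Type*} [AddCommGroup L] [Module ℂ L]

/-- Evaluation of a polynomial `p = Σₙ λⁿ • pₙ` with coefficients in `L`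
(encoded as the family of its coefficients) at an endomorphism `T` of `L`
(for instance at a scalar `λ`, or at an operator such as `-∂-λ`). -/
noncomputable def ev (T : Module.End ℂ L) (p : ℕ →₀ L) : L :=
  p.sum fun n x => (T ^ n) x

/-- `app m T x y` is `x ∘_T y` : the `λ`-product `x ∘_λ y` recorded by the
`ℂ`-bilinear coefficient map `m`, with the variable `λ` substituted by the
endomorphism `T`. -/
noncomputable def app (m : L →ₗ[ℂ] L →ₗ[ℂ] (ℕ →₀ L)) (T : Module.End ℂ L) (x y : L) : L :=
  ev T (m x y)

/-- The scalar `c` viewed as an endomorphism of `L`. -/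
noncomputable def sc (c : ℂ) : Module.End ℂ L := c • (1 : Module.End ℂ L)

/-- `(L, D, m)` is a conformal algebra: conformal sesquilinearity holds. -/
structure IsConfAlg (D : Module.End ℂ L) (m : L →ₗ[ℂ] L →ₗ[ℂ] (ℕ →₀ L)) : Prop where
  sesq_left : ∀ (x y : L) (l : ℂ), app m (sc l) (D x) y = -l • app m (sc l) x y
  sesq_right : ∀ (x y : L) (l : ℂ),
    app m (sc l) x (D y) = D (app m (sc l) x y) + l • app m (sc l) x y

/-- `(L, D, m)` is a commutative associative conformal algebra. -/
structure IsCommAssocConfAlg (D : Module.End ℂ L) (m : L →ₗ[ℂ] L →ₗ[ℂ] (ℕ →₀ L))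
    extends IsConfAlg D m : Prop where
  assoc : ∀ (x y z : L) (l u : ℂ),
    app m (sc l) x (app m (sc u) y z) = app m (sc (l + u)) (app m (sc l) x y) z
  comm : ∀ (x y : L) (l : ℂ), app m (sc l) x y = app m (-(D + sc l)) y x

/-- `(L, D, br)` is a Lie conformal algebra. -/
structure IsLieConfAlg (D : Module.End ℂ L) (br : L →ₗ[ℂ] L →ₗ[ℂ] (ℕ →₀ L)) : Prop where
  sesq_left : ∀ (x y : L) (l : ℂ), app br (sc l) (D x) y = -l • app br (sc l) x y
  skew : ∀ (x y : L) (l : ℂ), app br (sc l) x y = -app br (-(sc l + D)) y x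
  jacobi : ∀ (x y z : L) (l u : ℂ),
    app br (sc l) x (app br (sc u) y z) =
      app br (sc (l + u)) (app br (sc l) x y) z + app br (sc u) y (app br (sc l) x z)

/-- `(L, D, m, br)` is a transposed Poisson conformal algebra. -/
structure IsTPCA (D : Module.End ℂ L) (m br : L →ₗ[ℂ] L →ₗ[ℂ] (ℕ →₀ L)) : Prop where
  commAssoc : IsCommAssocConfAlg D m
  lie : IsLieConfAlg D br
  tLeibniz : ∀ (x y z : L) (l u : ℂ),
    (2 : ℂ) • app m (sc l) x (app br (sc u) y z) =
      app br (sc (l + u)) (app m (sc l) x y) z + app br (sc u) y (app m (sc l) x z)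


/-- `Dd` is a derivation of the conformal algebra `(L, D, m)` : it commutes
with `∂` and satisfies the Leibniz rule for the `λ`-product. -/
structure IsConfDerivation (D : Module.End ℂ L) (m : L →ₗ[ℂ] L →ₗ[ℂ] (ℕ →₀ L))
    (Dd : L →ₗ[ℂ] L) : Prop where
  comm_D : ∀ x : L, Dd (D x) = D (Dd x)
  leibniz : ∀ (x y : L) (l : ℂ),
    Dd (app m (sc l) x y) = app m (sc l) (Dd x) y + app m (sc l) x (Dd y)

theorem ev_eq_lsum (T : Module.End ℂ L) (p : ℕ →₀ L) :
    ev T p = Finsupp.lsum ℂ (fun n => T ^ n) p := rfl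

theorem sc_pow_apply (c : ℂ) (n : ℕ) (x : L) : (sc c ^ n : Module.End ℂ L) x = c ^ n • x := by
  simp [sc, smul_pow]

/-- A polynomial with coefficients in `L` is determined by its values at scalars. -/
theorem ext_of_ev_sc {p q : ℕ →₀ L} (h : ∀ l : ℂ, ev (sc l) p = ev (sc l) q) : p = q := by
  rw [← sub_eq_zero]
  have hr (l : ℂ) : ev (sc l) (p - q) = 0 := by
    simpa only [ev_eq_lsum, map_sub, sub_eq_zero] using h l
  generalize p - q = r at hr
  ext n
  refine (Module.forall_dual_apply_eq_zero_iff ℂ (r n)).mp fun f => ?_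
  let P : Polynomial ℂ := ∑ k ∈ r.support, Polynomial.monomial k (f (r k))
  have hP : P = 0 := Polynomial.funext fun l => by
    have := congrArg f (hr l)
    simpa [P, ev, Finsupp.sum, sc_pow_apply, Polynomial.eval_finsetSum, mul_comm] using this
  have := congrArg (fun Q => Polynomial.coeff Q n) hP
  simp only [P, Polynomial.finsetSum_coeff, Polynomial.coeff_monomial, Polynomial.coeff_zero,
    Finset.sum_ite_eq', Finsupp.mem_support_iff] at this
  by_cases hn : r n = 0
  · simp [hn]
  · simpa [hn] using this

section Linearity

variable (m : L →ₗ[ℂ] L →ₗ[ℂ] (ℕ →₀ L)) (T : Module.End ℂ L)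

theorem app_add_left (x x' y : L) : app m T (x + x') y = app m T x y + app m T x' y := by
  simp only [app, ev_eq_lsum, map_add, LinearMap.add_apply]

theorem app_sub_left (x x' y : L) : app m T (x - x') y = app m T x y - app m T x' y := by
  simp only [app, ev_eq_lsum, map_sub, LinearMap.sub_apply]

theorem app_neg_left (x y : L) : app m T (-x) y = -app m T x y := by
  simp only [app, ev_eq_lsum, map_neg, LinearMap.neg_apply]

theorem app_smul_left (c : ℂ) (x y : L) : app m T (c • x) y = c • app m T x y := by
  simp only [app, ev_eq_lsum, map_smul, LinearMap.smul_apply]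

theorem app_sum_left {ι : Type*} (s : Finset ι) (f : ι → L) (y : L) :
    app m T (∑ i ∈ s, f i) y = ∑ i ∈ s, app m T (f i) y := by
  simp only [app, ev_eq_lsum, map_sum, LinearMap.sum_apply]

theorem app_add_right (x y y' : L) : app m T x (y + y') = app m T x y + app m T x y' := by
  simp only [app, ev_eq_lsum, map_add]

theorem app_sub_right (x y y' : L) : app m T x (y - y') = app m T x y - app m T x y' := by
  simp only [app, ev_eq_lsum, map_sub]

end Linearity

section Conformal

variable {D : Module.End ℂ L} {m : L →ₗ[ℂ] L →ₗ[ℂ] (ℕ →₀ L)}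

theorem IsConfAlg.app_pow_left (hm : IsConfAlg D m) (c u : ℂ) (n : ℕ) (w z : L) :
    app m (sc c) (((-(D + sc u)) ^ n : Module.End ℂ L) w) z = (c - u) ^ n • app m (sc c) w z := by
  induction n with
  | zero => simp
  | succ n ih =>
    rw [pow_succ', Module.End.mul_apply]
    simp only [LinearMap.neg_apply, LinearMap.add_apply, sc, LinearMap.smul_apply,
      Module.End.one_apply, app_neg_left, app_add_left, app_smul_left]
    have h := hm.sesq_left (((-(D + sc u)) ^ n : Module.End ℂ L) w) z c
    simp only [sc] at h ih
    rw [h, ih]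
    module

/-- In the left factor of `(x ∘ y) ∘_c z`, the operator `-∂-u` acts as the scalar `c - u`. -/
theorem IsConfAlg.app_app_neg (hm : IsConfAlg D m) (c u : ℂ) (x y z : L) :
    app m (sc c) (app m (-(D + sc u)) x y) z = app m (sc c) (app m (sc (c - u)) x y) z := by
  conv_lhs => rw [app.eq_def m (-(D + sc u))]
  conv_rhs => rw [app.eq_def m (sc (c - u))]
  simp only [ev, Finsupp.sum, app_sum_left, hm.app_pow_left, sc_pow_apply, app_smul_left]

theorem IsCommAssocConfAlg.left_comm (hm : IsCommAssocConfAlg D m) (x y z : L) (l u : ℂ) :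
    app m (sc l) x (app m (sc u) y z) = app m (sc u) y (app m (sc l) x z) := by
  rw [hm.assoc, hm.assoc, hm.comm y x u, hm.app_app_neg, add_sub_cancel_left, add_comm u l]

end Conformal

/-- If `D` is a derivation of a commutative associative
conformal algebra `(N, ∘_λ)`, then the bracket
`[a_λ b] = a∘_λ D(b) − b∘_{−∂−λ} D(a)` makes `(N, ∘_λ, [·_λ·])` a transposed
Poisson conformal algebra. -/
theorem derivation_tpca {L : Type*} [AddCommGroup L] [Module ℂ L]
    (D : Module.End ℂ L) (m : L →ₗ[ℂ] L →ₗ[ℂ] (ℕ →₀ L))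
    (hm : IsCommAssocConfAlg D m)
    (Dd : L →ₗ[ℂ] L) (hDd : IsConfDerivation D m Dd)
    (br : L →ₗ[ℂ] L →ₗ[ℂ] (ℕ →₀ L))
    (hbr : ∀ (a b : L) (l : ℂ),
      app br (sc l) a b = app m (sc l) a (Dd b) - app m (-(D + sc l)) b (Dd a)) :
    IsTPCA D m br := by
  have hbr_sc (a b : L) (l : ℂ) :
      app br (sc l) a b = app m (sc l) a (Dd b) - app m (sc l) (Dd a) b := by
    rw [hbr, ← hm.comm]
  have hbr_coeff (a b : L) : br a b = m a (Dd b) - m (Dd a) b :=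
    ext_of_ev_sc fun l => by
      simpa only [app, ev_eq_lsum, map_sub] using hbr_sc a b l
  have hbr_end (T : Module.End ℂ L) (a b : L) :
      app br T a b = app m T a (Dd b) - app m T (Dd a) b := by
    simp only [app, hbr_coeff, ev_eq_lsum, map_sub]
  refine ⟨hm, ⟨fun x y l => ?_, fun x y l => ?_, fun x y z l u => ?_⟩, fun x y z l u => ?_⟩
  · rw [hbr_end, hbr_end, hDd.comm_D, hm.sesq_left, hm.sesq_left, smul_sub]
  · rw [hbr_end, hbr_end, add_comm (sc l) D, ← hm.comm, ← hm.comm, neg_sub]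
  · simp only [hbr_end, map_sub, hDd.leibniz, app_sub_left, app_add_left, app_sub_right,
      app_add_right, ← hm.assoc]
    simp only [hm.left_comm y _ _ u l, hm.left_comm (Dd y) _ _ u l]
    abel
  · simp only [hbr_end, hDd.leibniz, app_add_left, app_sub_right, app_add_right, ← hm.assoc]
    simp only [hm.left_comm y _ _ u l, hm.left_comm (Dd y) _ _ u l]
    module

end ConfFormal
end

section
/- Let (L, ∘_λ, ∗_λ) be a pre-Lie commutative conformal algebra satisfying in addition (a∘_λ b)∗_{λ+μ} c = a∘_λ(b∗_μ c) for all a, b, c ∈ L. Then (L, ∘_λ, ∗_λ) is a pre-Lie Poisson conformal algebra; that is, the identity (a∗_λ b)∘_{λ+μ} c − a∗_λ(b∘_μ c) = (b∗_μ a)∘_{λ+μ} c − b∗_μ(a∘_λ c) also holds for all a, b, c ∈ L. -/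
/-!
We model a `ℂ[∂]`-module as a complex vector space `L` together with an
endomorphism `D` (the action of `∂`).  A `λ`-product (or `λ`-bracket) is a
`ℂ`-bilinear map `L → L → L[λ]`, where the polynomial `x ∘_λ y = Σₙ λⁿ • cₙ`
is encoded by its finitely supported family of coefficients `ℕ →₀ L`.
Substitution of the variable `λ` by a complex scalar, or by an operator such
as `-∂-λ`, is given by `ev`; since `ℂ` is infinite, an identity of
polynomials in (several) variables `λ, μ, γ` with coefficients in a complex
vector space holds formally if and only if it holds for all complex values
of the variables, which is how all identities are stated below.
-/

namespace ConfFormal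

variable {L : Type*} [AddCommGroup L] [Module ℂ L]

/-- `(L, D, st)` is a left-symmetric (pre-Lie) conformal algebra. -/
structure IsLeftSymConfAlg (D : Module.End ℂ L) (st : L →ₗ[ℂ] L →ₗ[ℂ] (ℕ →₀ L))
    extends IsConfAlg D st : Prop where
  leftSym : ∀ (x y z : L) (l u : ℂ),
    app st (sc (l + u)) (app st (sc l) x y) z - app st (sc l) x (app st (sc u) y z)
      = app st (sc (l + u)) (app st (sc u) y x) z - app st (sc u) y (app st (sc l) x z)

/-- `(L, D, m, st)` is a pre-Lie commutative conformal algebra. -/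
structure IsPreLieCommConfAlg (D : Module.End ℂ L)
    (m st : L →ₗ[ℂ] L →ₗ[ℂ] (ℕ →₀ L)) : Prop where
  commAssoc : IsCommAssocConfAlg D m
  leftSym : IsLeftSymConfAlg D st
  compat : ∀ (x y z : L) (l u : ℂ),
    app st (sc l) x (app m (sc u) y z)
      = app m (sc (l + u)) (app st (sc l) x y) z + app m (sc u) y (app st (sc l) x z)

/-- `(L, D, m, st)` is a pre-Lie Poisson conformal algebra. -/
structure IsPreLiePoissonConfAlg (D : Module.End ℂ L)
    (m st : L →ₗ[ℂ] L →ₗ[ℂ] (ℕ →₀ L)) : Prop where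
  commAssoc : IsCommAssocConfAlg D m
  leftSym : IsLeftSymConfAlg D st
  compat₁ : ∀ (x y z : L) (l u : ℂ),
    app st (sc (l + u)) (app m (sc l) x y) z = app m (sc l) x (app st (sc u) y z)
  compat₂ : ∀ (x y z : L) (l u : ℂ),
    app m (sc (l + u)) (app st (sc l) x y) z - app st (sc l) x (app m (sc u) y z)
      = app m (sc (l + u)) (app st (sc u) y x) z - app st (sc u) y (app m (sc l) x z)

/-- Evaluation at a fixed endomorphism as a linear map. -/
noncomputable def evLinear (T : Module.End ℂ L) : (ℕ →₀ L) →ₗ[ℂ] L :=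
  Finsupp.lsum ℂ fun n => T ^ n

/-- The map `x ↦ x ∘_T z` as a linear map. -/
noncomputable def appLeft (m : L →ₗ[ℂ] L →ₗ[ℂ] (ℕ →₀ L)) (T : Module.End ℂ L) (z : L) :
    L →ₗ[ℂ] L :=
  evLinear T ∘ₗ m.flip z

theorem appLeft_apply (m : L →ₗ[ℂ] L →ₗ[ℂ] (ℕ →₀ L)) (T : Module.End ℂ L) (x z : L) :
    appLeft m T z x = app m T x z :=
  rfl

/-- Linear maps that intertwine `S` and `T` also intertwine the evaluations at `S` and `T`. -/
theorem map_ev_of_comm (f : L →ₗ[ℂ] L) {S T : Module.End ℂ L} (h : ∀ x, f (S x) = T (f x))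
    (p : ℕ →₀ L) : f (ev S p) = p.sum fun n x => (T ^ n) (f x) := by
  have hpow (n : ℕ) (x : L) : f ((S ^ n) x) = (T ^ n) (f x) := by
    induction n generalizing x with
    | zero => simp
    | succ n ih => rw [pow_succ, pow_succ, Module.End.mul_apply, Module.End.mul_apply, ih, h]
  simp only [ev, Finsupp.sum, map_sum, hpow]

/-- In a left argument of `∗_{λ+μ}`, a commutative product satisfies
`a ∘_λ b = b ∘_μ a`, because `∂` acts there as `-(λ+μ)`. -/
theorem app_app_comm {D : Module.End ℂ L} {m st : L →ₗ[ℂ] L →ₗ[ℂ] (ℕ →₀ L)}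
    (hm : IsCommAssocConfAlg D m) (hst : IsConfAlg D st) (x y z : L) (l u : ℂ) :
    app st (sc (l + u)) (app m (sc l) x y) z = app st (sc (l + u)) (app m (sc u) y x) z := by
  have hT (w : L) : appLeft st (sc (l + u)) z ((-(D + sc l) : Module.End ℂ L) w)
      = sc u (appLeft st (sc (l + u)) z w) := by
    have hD : appLeft st (sc (l + u)) z (D w) = -(l + u) • appLeft st (sc (l + u)) z w :=
      hst.sesq_left w z (l + u)
    simp only [sc, LinearMap.neg_apply, LinearMap.add_apply, LinearMap.smul_apply,
      Module.End.one_apply, map_neg, map_add, map_smul] at hD ⊢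
    rw [hD]
    module
  have hu (w : L) : appLeft st (sc (l + u)) z (sc u w)
      = sc u (appLeft st (sc (l + u)) z w) := by
    simp [sc]
  rw [hm.comm, ← appLeft_apply st, ← appLeft_apply st, app, app, map_ev_of_comm _ hT,
    map_ev_of_comm _ hu]

/-- A pre-Lie commutative conformal algebra satisfying
`(a∘_λ b)∗_{λ+μ} c = a∘_λ(b∗_μ c)` is a pre-Lie Poisson conformal algebra. -/
theorem preLieComm_preLiePoisson {L : Type*} [AddCommGroup L] [Module ℂ L]
    (D : Module.End ℂ L) (m st : L →ₗ[ℂ] L →ₗ[ℂ] (ℕ →₀ L))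
    (hPLC : IsPreLieCommConfAlg D m st)
    (hcompat : ∀ (x y z : L) (l u : ℂ),
      app st (sc (l + u)) (app m (sc l) x y) z = app m (sc l) x (app st (sc u) y z)) :
    IsPreLiePoissonConfAlg D m st := by
  refine ⟨hPLC.commAssoc, hPLC.leftSym, hcompat, fun x y z l u => ?_⟩
  have hxy : app m (sc l) x (app st (sc u) y z) = app m (sc u) y (app st (sc l) x z) := by
    rw [← hcompat x y z l u, ← hcompat y x z u l,
      app_app_comm hPLC.commAssoc hPLC.leftSym.toIsConfAlg, add_comm u l]
  have hyx := hPLC.compat y x z u l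
  rw [add_comm u l] at hyx
  rw [hPLC.compat x y z l u, hyx, hxy]
  abel

end ConfFormal
end
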